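/- arXiv:2311.14992 — 5 statements merged into one kernel-verified Lean document; each statement's English description precedes it below -/
import Mathlib

section
/- Let P₁, P₂ be symmetric n×n real matrices, let Δ₁ := γ²I + C₂ᵀP₁C₂ + C₁ᵀP₁C₁ and Δ₂ := I + B₁ᵀP₂B₁ be invertible, and let K₁ ∈ ℝ^{m₂×n}, K₂ ∈ ℝ^{m₁×n} satisfy the coupled gain equations K₁ = −Δ₁⁻¹M₁ᵀ and K₂ = −Δ₂⁻¹M₂ᵀ, where M₁ := (A₁ + B₁K₂)ᵀP₁C₁ + A₂ᵀP₁C₂ and M₂ := (A₁ + C₁K₁)ᵀP₂B₁. If the (m₂+m₁)×(m₂+m₁) block matrix S := [[Δ₁, C₁ᵀP₁B₁], [B₁ᵀP₂C₁, Δ₂]] is invertible, then the vertically stacked gain matrix [K₁; K₂] ∈ ℝ^{(m₂+m₁)×n} equals −S⁻¹ · [C₁ᵀP₁A₁ + C₂ᵀP₁A₂; B₁ᵀP₂A₁]. -/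
open Matrix

/-- The coupled gain equations `K₁ = −Δ₁⁻¹M₁ᵀ`, `K₂ = −Δ₂⁻¹M₂ᵀ` are
equivalent to the stacked-gain formula `[K₁; K₂] = −S⁻¹ [C₁ᵀP₁A₁ + C₂ᵀP₁A₂; B₁ᵀP₂A₁]`,
where `S` is the indicated block matrix. -/
theorem stacked_gain_formula
    (n m₁ m₂ : ℕ) (hn : 0 < n) (hm₁ : 0 < m₁) (hm₂ : 0 < m₂)
    (A₁ A₂ : Matrix (Fin n) (Fin n) ℝ)
    (B₁ : Matrix (Fin n) (Fin m₁) ℝ)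
    (C₁ C₂ : Matrix (Fin n) (Fin m₂) ℝ)
    (Q : Matrix (Fin n) (Fin n) ℝ) (hQ : Qᵀ = Q)
    (γ : ℝ) (hγ : 0 < γ)
    (P₁ P₂ : Matrix (Fin n) (Fin n) ℝ) (hP₁ : P₁ᵀ = P₁) (hP₂ : P₂ᵀ = P₂)
    (K₁ : Matrix (Fin m₂) (Fin n) ℝ) (K₂ : Matrix (Fin m₁) (Fin n) ℝ)
    (Δ₁ : Matrix (Fin m₂) (Fin m₂) ℝ)
    (hΔ₁def : Δ₁ = γ ^ 2 • (1 : Matrix (Fin m₂) (Fin m₂) ℝ) + C₂ᵀ * P₁ * C₂ + C₁ᵀ * P₁ * C₁)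
    (Δ₂ : Matrix (Fin m₁) (Fin m₁) ℝ)
    (hΔ₂def : Δ₂ = 1 + B₁ᵀ * P₂ * B₁)
    (hΔ₁ : IsUnit Δ₁) (hΔ₂ : IsUnit Δ₂)
    (M₁ : Matrix (Fin n) (Fin m₂) ℝ)
    (hM₁ : M₁ = (A₁ + B₁ * K₂)ᵀ * P₁ * C₁ + A₂ᵀ * P₁ * C₂)
    (M₂ : Matrix (Fin n) (Fin m₁) ℝ)
    (hM₂ : M₂ = (A₁ + C₁ * K₁)ᵀ * P₂ * B₁)
    (hK₁ : K₁ = -(Δ₁⁻¹ * M₁ᵀ)) (hK₂ : K₂ = -(Δ₂⁻¹ * M₂ᵀ))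
    (S : Matrix (Fin m₂ ⊕ Fin m₁) (Fin m₂ ⊕ Fin m₁) ℝ)
    (hS : S = fromBlocks Δ₁ (C₁ᵀ * P₁ * B₁) (B₁ᵀ * P₂ * C₁) Δ₂)
    (hSinv : IsUnit S) :
    fromRows K₁ K₂ =
      -(S⁻¹ * fromRows (C₁ᵀ * P₁ * A₁ + C₂ᵀ * P₁ * A₂) (B₁ᵀ * P₂ * A₁)) := by
  have hdet₁ : IsUnit Δ₁.det := (isUnit_iff_isUnit_det Δ₁).1 hΔ₁
  have hdet₂ : IsUnit Δ₂.det := (isUnit_iff_isUnit_det Δ₂).1 hΔ₂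
  have hdet : IsUnit S.det := (isUnit_iff_isUnit_det S).1 hSinv
  have gain₁ : Δ₁ * K₁ = -M₁ᵀ := by
    rw [hK₁, Matrix.mul_neg, mul_nonsing_inv_cancel_left _ _ hdet₁]
  have gain₂ : Δ₂ * K₂ = -M₂ᵀ := by
    rw [hK₂, Matrix.mul_neg, mul_nonsing_inv_cancel_left _ _ hdet₂]
  have stacked : S * fromRows K₁ K₂ =
      -fromRows (C₁ᵀ * P₁ * A₁ + C₂ᵀ * P₁ * A₂) (B₁ᵀ * P₂ * A₁) := by
    rw [hS, fromBlocks_mul_fromRows, gain₁, gain₂, hM₁, hM₂, fromRows_neg]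
    simp only [transpose_add, transpose_mul, transpose_transpose, hP₁, hP₂,
      Matrix.add_mul, Matrix.mul_assoc]
    congr 1 <;> abel
  rw [← Matrix.mul_neg, ← stacked, nonsing_inv_mul_cancel_left _ _ hdet]
end

section
/- Let P₁, P₂ be symmetric n×n real matrices, suppose Δ₁ := γ²I + C₂ᵀP₁C₂ + C₁ᵀP₁C₁ and Δ₂ := I + B₁ᵀP₂B₁ are invertible, and let K₁ ∈ ℝ^{m₂×n}, K₂ ∈ ℝ^{m₁×n} satisfy K₁ = −Δ₁⁻¹M₁ᵀ and K₂ = −Δ₂⁻¹M₂ᵀ, where M₁ := (A₁ + B₁K₂)ᵀP₁C₁ + A₂ᵀP₁C₂ and M₂ := (A₁ + C₁K₁)ᵀP₂B₁. Then the value-iteration updates can be written in compact closed-loop form: (A₁ + B₁K₂)ᵀP₁(A₁ + B₁K₂) + A₂ᵀP₁A₂ − Q − K₂ᵀK₂ − M₁Δ₁⁻¹M₁ᵀ = 𝒜(P₁, K₁, K₂) − Q − K₂ᵀK₂ + γ²K₁ᵀK₁, and (A₁ + C₁K₁)ᵀP₂(A₁ + C₁K₁) + (A₂ + C₂K₁)ᵀP₂(A₂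 + C₂K₁) + Q − M₂Δ₂⁻¹M₂ᵀ = 𝒜(P₂, K₁, K₂) + Q + K₂ᵀK₂. -/
open Matrix

/-- The closed-loop operator
`𝒜(X, Y₁, Y₂) = (A₂ + C₂Y₁)ᵀX(A₂ + C₂Y₁) + (A₁ + B₁Y₂ + C₁Y₁)ᵀX(A₁ + B₁Y₂ + C₁Y₁)`. -/
def closedLoopA {n m₁ m₂ : ℕ} (A₁ A₂ : Matrix (Fin n) (Fin n) ℝ)
    (B₁ : Matrix (Fin n) (Fin m₁) ℝ) (C₁ C₂ : Matrix (Fin n) (Fin m₂) ℝ)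
    (X : Matrix (Fin n) (Fin n) ℝ) (Y₁ : Matrix (Fin m₂) (Fin n) ℝ)
    (Y₂ : Matrix (Fin m₁) (Fin n) ℝ) : Matrix (Fin n) (Fin n) ℝ :=
  (A₂ + C₂ * Y₁)ᵀ * X * (A₂ + C₂ * Y₁) +
    (A₁ + B₁ * Y₂ + C₁ * Y₁)ᵀ * X * (A₁ + B₁ * Y₂ + C₁ * Y₁)

/-- If `K` is the gain `-Δ⁻¹Mᵀ`, then the quadratic form `MK + KᵀMᵀ + KᵀΔK` attains the value
`-MΔ⁻¹Mᵀ`. -/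
theorem Matrix.mul_nonsing_inv_mul_transpose_eq_of_gain {n m R : Type*} [Fintype n] [Fintype m]
    [DecidableEq m] [CommRing R] {Δ : Matrix m m R} (hΔ : IsUnit Δ) {M : Matrix n m R}
    {K : Matrix m n R} (hK : K = -(Δ⁻¹ * Mᵀ)) :
    M * Δ⁻¹ * Mᵀ = -(M * K + Kᵀ * Mᵀ + Kᵀ * Δ * K) := by
  have hΔK : Δ * K = -Mᵀ := by
    rw [hK, Matrix.mul_neg, mul_nonsing_inv_cancel_left _ _ ((isUnit_iff_isUnit_det Δ).1 hΔ)]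
  have hMK : M * K = -(M * Δ⁻¹ * Mᵀ) := by rw [hK, Matrix.mul_neg, Matrix.mul_assoc]
  rw [Matrix.mul_assoc Kᵀ, hΔK, hMK, Matrix.mul_neg]
  abel

/-- with coupled gains `K₁ = −Δ₁⁻¹M₁ᵀ` and `K₂ = −Δ₂⁻¹M₂ᵀ`, the
value-iteration updates can be written in compact closed-loop form. -/
theorem value_iteration_compact_closed_loop_form
    (n m₁ m₂ : ℕ) (hn : 0 < n) (hm₁ : 0 < m₁) (hm₂ : 0 < m₂)
    (A₁ A₂ : Matrix (Fin n) (Fin n) ℝ)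
    (B₁ : Matrix (Fin n) (Fin m₁) ℝ)
    (C₁ C₂ : Matrix (Fin n) (Fin m₂) ℝ)
    (Q : Matrix (Fin n) (Fin n) ℝ) (hQ : Qᵀ = Q)
    (γ : ℝ) (hγ : 0 < γ)
    (P₁ P₂ : Matrix (Fin n) (Fin n) ℝ) (hP₁ : P₁ᵀ = P₁) (hP₂ : P₂ᵀ = P₂)
    (K₁ : Matrix (Fin m₂) (Fin n) ℝ) (K₂ : Matrix (Fin m₁) (Fin n) ℝ)
    (Δ₁ : Matrix (Fin m₂) (Fin m₂) ℝ)
    (hΔ₁def : Δ₁ = γ ^ 2 • (1 : Matrix (Fin m₂) (Fin m₂) ℝ) + C₂ᵀ * P₁ * C₂ + C₁ᵀ * P₁ * C₁)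
    (Δ₂ : Matrix (Fin m₁) (Fin m₁) ℝ)
    (hΔ₂def : Δ₂ = 1 + B₁ᵀ * P₂ * B₁)
    (hΔ₁ : IsUnit Δ₁) (hΔ₂ : IsUnit Δ₂)
    (M₁ : Matrix (Fin n) (Fin m₂) ℝ)
    (hM₁ : M₁ = (A₁ + B₁ * K₂)ᵀ * P₁ * C₁ + A₂ᵀ * P₁ * C₂)
    (M₂ : Matrix (Fin n) (Fin m₁) ℝ)
    (hM₂ : M₂ = (A₁ + C₁ * K₁)ᵀ * P₂ * B₁)
    (hK₁ : K₁ = -(Δ₁⁻¹ * M₁ᵀ)) (hK₂ : K₂ = -(Δ₂⁻¹ * M₂ᵀ)) :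
    ((A₁ + B₁ * K₂)ᵀ * P₁ * (A₁ + B₁ * K₂) + A₂ᵀ * P₁ * A₂ - Q - K₂ᵀ * K₂
        - M₁ * Δ₁⁻¹ * M₁ᵀ =
      closedLoopA A₁ A₂ B₁ C₁ C₂ P₁ K₁ K₂ - Q - K₂ᵀ * K₂ + γ ^ 2 • (K₁ᵀ * K₁)) ∧
    ((A₁ + C₁ * K₁)ᵀ * P₂ * (A₁ + C₁ * K₁) + (A₂ + C₂ * K₁)ᵀ * P₂ * (A₂ + C₂ * K₁)
        + Q - M₂ * Δ₂⁻¹ * M₂ᵀ =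
      closedLoopA A₁ A₂ B₁ C₁ C₂ P₂ K₁ K₂ + Q + K₂ᵀ * K₂) := by
  constructor
  · rw [mul_nonsing_inv_mul_transpose_eq_of_gain hΔ₁ hK₁, hΔ₁def, hM₁, closedLoopA]
    clear hK₁ hK₂ hM₁ hM₂
    generalize A₁ + B₁ * K₂ = A
    simp only [transpose_add, transpose_mul, transpose_transpose, hP₁, Matrix.add_mul,
      Matrix.mul_add, Matrix.mul_assoc, Matrix.smul_mul, Matrix.mul_smul, Matrix.one_mul]
    abel
  · rw [mul_nonsing_inv_mul_transpose_eq_of_gain hΔ₂ hK₂, hΔ₂def, hM₂, closedLoopA,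
      add_right_comm A₁ (B₁ * K₂)]
    clear hK₁ hK₂ hM₁ hM₂
    generalize A₁ + C₁ * K₁ = A
    generalize A₂ + C₂ * K₁ = F
    simp only [transpose_add, transpose_mul, transpose_transpose, hP₂, Matrix.add_mul,
      Matrix.mul_add, Matrix.mul_assoc, Matrix.one_mul]
    abel
end

section
/- (Positivity of the sum of the two value sequences.) Let (K₁^{(i)})_{i≥0} in ℝ^{m₂×n} and (K₂^{(i)})_{i≥0} in ℝ^{m₁×n} be any gain sequences and define P₁^{(0)} = P₂^{(0)} = 0, P₁^{(i+1)} := −Q − K₂^{(i)ᵀ}K₂^{(i)} + γ²K₁^{(i)ᵀ}K₁^{(i)} + 𝒜(P₁^{(i)}, K₁^{(i)}, K₂^{(i)}) and P₂^{(i+1)} := Q + K₂^{(i)ᵀ}K₂^{(i)} + 𝒜(P₂^{(i)}, K₁^{(i)}, K₂^{(i)}). Then for every i ≥ 0 the matrix P₁^{(i)} + P₂^{(i)} is positive semidefinite. -/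
open Matrix

theorem closedLoopA_add {n m₁ m₂ : ℕ} (A₁ A₂ : Matrix (Fin n) (Fin n) ℝ)
    (B₁ : Matrix (Fin n) (Fin m₁) ℝ) (C₁ C₂ : Matrix (Fin n) (Fin m₂) ℝ)
    (X X' : Matrix (Fin n) (Fin n) ℝ) (Y₁ : Matrix (Fin m₂) (Fin n) ℝ)
    (Y₂ : Matrix (Fin m₁) (Fin n) ℝ) :
    closedLoopA A₁ A₂ B₁ C₁ C₂ (X + X') Y₁ Y₂ =
      closedLoopA A₁ A₂ B₁ C₁ C₂ X Y₁ Y₂ + closedLoopA A₁ A₂ B₁ C₁ C₂ X' Y₁ Y₂ := by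
  simp only [closedLoopA, Matrix.mul_add _ X X', Matrix.add_mul (_ * X) (_ * X')]
  abel

theorem closedLoopA_posSemidef {n m₁ m₂ : ℕ} (A₁ A₂ : Matrix (Fin n) (Fin n) ℝ)
    (B₁ : Matrix (Fin n) (Fin m₁) ℝ) (C₁ C₂ : Matrix (Fin n) (Fin m₂) ℝ)
    {X : Matrix (Fin n) (Fin n) ℝ} (hX : X.PosSemidef) (Y₁ : Matrix (Fin m₂) (Fin n) ℝ)
    (Y₂ : Matrix (Fin m₁) (Fin n) ℝ) :
    (closedLoopA A₁ A₂ B₁ C₁ C₂ X Y₁ Y₂).PosSemidef := by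
  simp only [closedLoopA, ← conjTranspose_eq_transpose_of_trivial]
  exact (hX.conjTranspose_mul_mul_same _).add (hX.conjTranspose_mul_mul_same _)

/-- Positivity of the sum of the two value sequences: for any gain
sequences, `P₁^{(i)} + P₂^{(i)} ⪰ 0` for every `i`. -/
theorem sum_of_value_sequences_posSemidef
    (n m₁ m₂ : ℕ) (hn : 0 < n) (hm₁ : 0 < m₁) (hm₂ : 0 < m₂)
    (A₁ A₂ : Matrix (Fin n) (Fin n) ℝ)
    (B₁ : Matrix (Fin n) (Fin m₁) ℝ)
    (C₁ C₂ : Matrix (Fin n) (Fin m₂) ℝ)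
    (Q : Matrix (Fin n) (Fin n) ℝ) (hQ : Qᵀ = Q)
    (γ : ℝ) (hγ : 0 < γ)
    (K₁ : ℕ → Matrix (Fin m₂) (Fin n) ℝ) (K₂ : ℕ → Matrix (Fin m₁) (Fin n) ℝ)
    (P₁ P₂ : ℕ → Matrix (Fin n) (Fin n) ℝ)
    (hP₁0 : P₁ 0 = 0) (hP₂0 : P₂ 0 = 0)
    (hP₁ : ∀ i, P₁ (i + 1) =
      -Q - (K₂ i)ᵀ * K₂ i + γ ^ 2 • ((K₁ i)ᵀ * K₁ i)
        + closedLoopA A₁ A₂ B₁ C₁ C₂ (P₁ i) (K₁ i) (K₂ i))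
    (hP₂ : ∀ i, P₂ (i + 1) =
      Q + (K₂ i)ᵀ * K₂ i + closedLoopA A₁ A₂ B₁ C₁ C₂ (P₂ i) (K₁ i) (K₂ i)) :
    ∀ i, (P₁ i + P₂ i).PosSemidef := by
  intro i
  induction i with
  | zero => simpa [hP₁0, hP₂0] using PosSemidef.zero
  | succ i ih =>
    have hsum : P₁ (i + 1) + P₂ (i + 1) = γ ^ 2 • ((K₁ i)ᵀ * K₁ i) +
        closedLoopA A₁ A₂ B₁ C₁ C₂ (P₁ i + P₂ i) (K₁ i) (K₂ i) := by
      rw [hP₁, hP₂, closedLoopA_add]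
      abel
    have hK : ((K₁ i)ᵀ * K₁ i).PosSemidef := by
      simpa only [conjTranspose_eq_transpose_of_trivial] using
        posSemidef_conjTranspose_mul_self (K₁ i)
    rw [hsum]
    exact (hK.smul (sq_nonneg γ)).add (closedLoopA_posSemidef A₁ A₂ B₁ C₁ C₂ ih _ _)
end

section
/- (Stochastic Lyapunov stability criterion.) Let A₁, A₂ ∈ ℝ^{n×n} and define the second-moment map 𝒯 on n×n real matrices by 𝒯(X) := A₁XA₁ᵀ + A₂XA₂ᵀ, so that for the stochastic system x_{k+1} = A₁x_k + A₂x_kω_k (with ω_k independent zero-mean unit-variance noise) the covariance E(x_k x_kᵀ) evolves by 𝒯. Then the following are equivalent: (i) for every positive semidefinite X₀ ∈ ℝ^{n×n}, the iterates 𝒯^k(X₀) converge to the zero matrix as k → ∞ (asymptotic mean-square stability); (ii) there exists a symmetric positive definite matrix P ∈ ℝ^{n×n} such that A₁ᵀPA₁ + A₂ᵀPA₂ − P is negative definite. -/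
open Matrix Filter

section SecondMoment

variable {ι : Type*} [Fintype ι]

/-- The second-moment map `X ↦ A X Aᵀ + B X Bᵀ`. -/
def secondMomentMap (A B X : Matrix ι ι ℝ) : Matrix ι ι ℝ :=
  A * X * Aᵀ + B * X * Bᵀ

theorem secondMomentMap_add (A B X Y : Matrix ι ι ℝ) :
    secondMomentMap A B (X + Y) = secondMomentMap A B X + secondMomentMap A B Y := by
  simp only [secondMomentMap, Matrix.mul_add, Matrix.add_mul]
  abel

theorem secondMomentMap_sum (A B : Matrix ι ι ℝ) (f : ℕ → Matrix ι ι ℝ) (N : ℕ) :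
    secondMomentMap A B (∑ k ∈ Finset.range N, f k) =
      ∑ k ∈ Finset.range N, secondMomentMap A B (f k) := by
  induction N with
  | zero => simp [secondMomentMap]
  | succ N ih => rw [Finset.sum_range_succ, secondMomentMap_add, ih, Finset.sum_range_succ]

theorem posSemidef_secondMomentMap (A B : Matrix ι ι ℝ) {X : Matrix ι ι ℝ}
    (hX : X.PosSemidef) : (secondMomentMap A B X).PosSemidef :=
  (hX.mul_mul_conjTranspose_same A).add (hX.mul_mul_conjTranspose_same B)

theorem posSemidef_secondMomentMap_iterate (A B : Matrix ι ι ℝ) {X : Matrix ι ι ℝ}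
    (hX : X.PosSemidef) (k : ℕ) : ((secondMomentMap A B)^[k] X).PosSemidef := by
  induction k with
  | zero => exact hX
  | succ k ih =>
    rw [Function.iterate_succ_apply']
    exact posSemidef_secondMomentMap A B ih

/-- The map with transposed coefficients is the adjoint for the trace pairing. -/
theorem trace_mul_secondMomentMap (A B P X : Matrix ι ι ℝ) :
    (P * secondMomentMap A B X).trace = (secondMomentMap Aᵀ Bᵀ P * X).trace := by
  simp only [secondMomentMap, transpose_transpose, Matrix.mul_add, Matrix.add_mul, trace_add]
  congr 1
  · rw [← Matrix.mul_assoc, trace_mul_comm]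
    simp only [Matrix.mul_assoc]
  · rw [← Matrix.mul_assoc, trace_mul_comm]
    simp only [Matrix.mul_assoc]

theorem trace_mul_secondMomentMap_iterate (A B P X : Matrix ι ι ℝ) (k : ℕ) :
    (P * (secondMomentMap A B)^[k] X).trace =
      ((secondMomentMap Aᵀ Bᵀ)^[k] P * X).trace := by
  induction k generalizing P with
  | zero => rfl
  | succ k ih =>
    rw [Function.iterate_succ_apply', trace_mul_secondMomentMap, ih, Function.iterate_succ_apply]

open scoped MatrixOrder Matrix.Norms.L2Operator in
theorem Matrix.PosSemidef.exists_transpose_mul_self {X : Matrix ι ι ℝ} (hX : X.PosSemidef) :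
    ∃ B : Matrix ι ι ℝ, X = Bᵀ * B := by
  classical
  obtain ⟨B, hB⟩ := CStarAlgebra.nonneg_iff_eq_star_mul_self.mp hX.nonneg
  exact ⟨B, hB⟩

theorem Matrix.PosSemidef.trace_mul_nonneg {P X : Matrix ι ι ℝ} (hP : P.PosSemidef)
    (hX : X.PosSemidef) : 0 ≤ (P * X).trace := by
  obtain ⟨B, rfl⟩ := hP.exists_transpose_mul_self
  rw [Matrix.mul_assoc, trace_mul_comm]
  exact (hX.mul_mul_conjTranspose_same B).trace_nonneg

theorem Matrix.PosSemidef.abs_apply_le_trace {X : Matrix ι ι ℝ} (hX : X.PosSemidef) (i j : ι) :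
    |X i j| ≤ X.trace := by
  have hdiag (i : ι) : X i i ≤ X.trace :=
    Finset.single_le_sum (f := fun i => X i i) (fun _ _ => hX.diag_nonneg) (Finset.mem_univ i)
  have hi := hdiag i
  have hj := hdiag j
  obtain ⟨B, rfl⟩ := hX.exists_transpose_mul_self
  have h1 : 0 ≤ ∑ k, (B k i + B k j) ^ 2 := by positivity
  have h2 : 0 ≤ ∑ k, (B k i - B k j) ^ 2 := by positivity
  simp only [mul_apply, transpose_apply] at hi hj ⊢
  have e1 : ∑ k, (B k i + B k j) ^ 2 =
      ∑ k, B k i * B k i + ∑ k, B k j * B k j + 2 * ∑ k, B k i * B k j := by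
    rw [Finset.mul_sum, ← Finset.sum_add_distrib, ← Finset.sum_add_distrib]
    exact Finset.sum_congr rfl fun _ _ => by ring
  have e2 : ∑ k, (B k i - B k j) ^ 2 =
      ∑ k, B k i * B k i + ∑ k, B k j * B k j - 2 * ∑ k, B k i * B k j := by
    rw [Finset.mul_sum, ← Finset.sum_add_distrib, ← Finset.sum_sub_distrib]
    exact Finset.sum_congr rfl fun _ _ => by ring
  rw [abs_le]
  constructor <;> linarith

theorem Matrix.PosSemidef.dotProduct_mulVec_le_trace_mul {X : Matrix ι ι ℝ} (hX : X.PosSemidef)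
    (x : ι → ℝ) : x ⬝ᵥ (X *ᵥ x) ≤ X.trace * (x ⬝ᵥ x) := by
  obtain ⟨B, rfl⟩ := hX.exists_transpose_mul_self
  have hform : x ⬝ᵥ ((Bᵀ * B) *ᵥ x) = ∑ i, (∑ j, B i j * x j) ^ 2 := by
    rw [← mulVec_mulVec, dotProduct_mulVec, vecMul_transpose]
    simp only [dotProduct, mulVec, sq]
  have htrace : (Bᵀ * B).trace = ∑ i, ∑ j, B i j ^ 2 := by
    simp only [trace, diag_apply, mul_apply, transpose_apply, sq]
    exact Finset.sum_comm
  have hx : x ⬝ᵥ x = ∑ j, x j ^ 2 := by simp only [dotProduct, sq]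
  rw [hform, htrace, hx, Finset.sum_mul]
  exact Finset.sum_le_sum fun i _ => Finset.sum_mul_sq_le_sq_mul_sq _ _ _

theorem Matrix.PosSemidef.posDef_one_sub [DecidableEq ι] {X : Matrix ι ι ℝ} (hX : X.PosSemidef)
    (htr : X.trace < 1) : (1 - X).PosDef := by
  refine PosDef.of_dotProduct_mulVec_pos (isHermitian_one.sub hX.isHermitian) fun x hx => ?_
  have hpos : 0 < x ⬝ᵥ x := by simpa using (PosDef.one (n := ι) (R := ℝ)).dotProduct_mulVec_pos hx
  have hle := hX.dotProduct_mulVec_le_trace_mul x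
  rw [star_trivial, sub_mulVec, one_mulVec, dotProduct_sub]
  nlinarith

theorem tendsto_zero_of_trace_tendsto_zero {X : ℕ → Matrix ι ι ℝ} (hX : ∀ k, (X k).PosSemidef)
    (h : Tendsto (fun k => (X k).trace) atTop (nhds 0)) : Tendsto X atTop (nhds 0) := by
  refine tendsto_pi_nhds.2 fun i => tendsto_pi_nhds.2 fun j => ?_
  exact squeeze_zero_norm (fun k => (hX k).abs_apply_le_trace i j) h

theorem tendsto_zero_of_trace_mul_tendsto_zero {Q : Matrix ι ι ℝ} (hQ : Q.PosDef)
    {X : ℕ → Matrix ι ι ℝ} (hX : ∀ k, (X k).PosSemidef)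
    (h : Tendsto (fun k => (Q * X k).trace) atTop (nhds 0)) : Tendsto X atTop (nhds 0) := by
  classical
  obtain ⟨B, rfl⟩ := hQ.posSemidef.exists_transpose_mul_self
  have hB : IsUnit B.det := by
    have := (isUnit_iff_isUnit_det _).1 hQ.isUnit
    rw [det_mul] at this
    exact isUnit_of_mul_isUnit_right this
  have hlim : Tendsto (fun k => B * X k * Bᵀ) atTop (nhds 0) := by
    refine tendsto_zero_of_trace_tendsto_zero
      (fun k => (hX k).mul_mul_conjTranspose_same B) (h.congr fun k => ?_)
    rw [Matrix.mul_assoc, trace_mul_comm]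
  have hcont : Continuous fun Y : Matrix ι ι ℝ => B⁻¹ * Y * (Bᵀ)⁻¹ := by fun_prop
  have := (hcont.tendsto 0).comp hlim
  rw [Matrix.mul_zero, Matrix.zero_mul] at this
  refine this.congr fun k => ?_
  have hBt : IsUnit (Bᵀ).det := by rwa [det_transpose]
  simp only [Function.comp_apply, Matrix.mul_assoc, mul_nonsing_inv _ hBt, Matrix.mul_one]
  rw [← Matrix.mul_assoc, nonsing_inv_mul _ hB, Matrix.one_mul]

theorem tendsto_iterate_of_posDef_sub (A B : Matrix ι ι ℝ) {P : Matrix ι ι ℝ}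
    (hP : P.PosSemidef) (hQ : (P - secondMomentMap Aᵀ Bᵀ P).PosDef) {X : Matrix ι ι ℝ}
    (hX : X.PosSemidef) : Tendsto (fun k => (secondMomentMap A B)^[k] X) atTop (nhds 0) := by
  have hXk := posSemidef_secondMomentMap_iterate A B hX
  refine tendsto_zero_of_trace_mul_tendsto_zero hQ hXk ?_
  set v : ℕ → ℝ := fun k => (P * (secondMomentMap A B)^[k] X).trace
  have hstep (k : ℕ) : v k - v (k + 1) =
      ((P - secondMomentMap Aᵀ Bᵀ P) * (secondMomentMap A B)^[k] X).trace := by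
    simp only [v, Function.iterate_succ_apply', trace_mul_secondMomentMap, Matrix.sub_mul,
      trace_sub]
  have hanti : Antitone v := antitone_nat_of_succ_le fun k => by
    have := hQ.posSemidef.trace_mul_nonneg (hXk k)
    rw [← hstep] at this
    linarith
  have hlim := tendsto_atTop_ciInf hanti
    ⟨0, by rintro _ ⟨k, rfl⟩; exact hP.trace_mul_nonneg (hXk k)⟩
  have hdiff := hlim.sub (hlim.comp (tendsto_add_atTop_nat 1))
  rw [sub_self] at hdiff
  exact hdiff.congr hstep

theorem exists_posDef_sub_of_tendsto_iterate [DecidableEq ι] (A B : Matrix ι ι ℝ)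
    (h : Tendsto (fun k => (secondMomentMap A B)^[k] 1) atTop (nhds 0)) :
    ∃ P : Matrix ι ι ℝ, P.PosDef ∧ (P - secondMomentMap Aᵀ Bᵀ P).PosDef := by
  have hcont : Continuous fun Y : Matrix ι ι ℝ => Y.trace := by fun_prop
  have htr := (hcont.tendsto 0).comp h
  rw [trace_zero] at htr
  obtain ⟨N, hN⟩ := eventually_atTop.1 (htr.eventually (gt_mem_nhds one_pos))
  have hlt : ((secondMomentMap Aᵀ Bᵀ)^[N + 1] 1).trace < 1 := by
    have := trace_mul_secondMomentMap_iterate A B 1 1 (N + 1)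
    rw [Matrix.one_mul, Matrix.mul_one] at this
    exact this ▸ hN (N + 1) N.le_succ
  have hpsd := posSemidef_secondMomentMap_iterate Aᵀ Bᵀ (PosSemidef.one (n := ι) (R := ℝ))
  refine ⟨∑ k ∈ Finset.range (N + 1), (secondMomentMap Aᵀ Bᵀ)^[k] 1, ?_, ?_⟩
  · rw [Finset.sum_range_succ']
    exact PosDef.posSemidef_add (posSemidef_sum _ fun k _ => hpsd (k + 1)) PosDef.one
  · simp only [secondMomentMap_sum, ← Function.iterate_succ_apply' (secondMomentMap Aᵀ Bᵀ)]
    rw [← Finset.sum_sub_distrib, Finset.sum_range_sub']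
    exact (hpsd (N + 1)).posDef_one_sub hlt

end SecondMoment

/-- Stochastic Lyapunov stability criterion: for the stochastic
system `x_{k+1} = A₁x_k + A₂x_kω_k` with second-moment map
`𝒯(X) = A₁XA₁ᵀ + A₂XA₂ᵀ`, asymptotic mean-square stability (convergence of
`𝒯^k(X₀)` to `0` for every PSD `X₀`) is equivalent to the existence of a
symmetric positive definite `P` with `A₁ᵀPA₁ + A₂ᵀPA₂ − P` negative definite. -/
theorem stochastic_lyapunov_stability_criterion
    (n : ℕ) (hn : 0 < n)
    (A₁ A₂ : Matrix (Fin n) (Fin n) ℝ) :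
    (∀ X₀ : Matrix (Fin n) (Fin n) ℝ, X₀.PosSemidef →
        Tendsto (fun k => (fun X => A₁ * X * A₁ᵀ + A₂ * X * A₂ᵀ)^[k] X₀)
          atTop (nhds 0)) ↔
    (∃ P : Matrix (Fin n) (Fin n) ℝ, P.PosDef ∧
        (-(A₁ᵀ * P * A₁ + A₂ᵀ * P * A₂ - P)).PosDef) := by
  have hneg (P : Matrix (Fin n) (Fin n) ℝ) :
      -(A₁ᵀ * P * A₁ + A₂ᵀ * P * A₂ - P) = P - secondMomentMap A₁ᵀ A₂ᵀ P := by
    rw [neg_sub]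
    rfl
  simp only [hneg]
  exact ⟨fun h => exists_posDef_sub_of_tendsto_iterate A₁ A₂ (h 1 PosSemidef.one),
    fun ⟨_, hP, hQ⟩ _ hX => tendsto_iterate_of_posDef_sub A₁ A₂ hP.posSemidef hQ hX⟩
end

section
/- (Stability under the strict stopping condition.) Let K₁ ∈ ℝ^{m₂×n}, K₂ ∈ ℝ^{m₁×n} be gain matrices and set F := A₁ + B₁K₂ + C₁K₁ and G := A₂ + C₂K₁ (the closed-loop coefficient matrices under u_k = K₂x_k and v_k = K₁x_k). Suppose there exists a symmetric positive definite matrix P ∈ ℝ^{n×n} such that 𝒜-type Lyapunov decrease holds: FᵀPF + GᵀPG − P is negative definite (this is exactly what the stopping condition Q₂^{(i+1)} − Q₂^{(i)} < r₂ of the Q-learning algorithm guarantees with P = P₂^{(i)} ≻ 0, since Q₂^{(i+1)}(x, u^{(i+1)}, v^{(i+1)}) − Q₂^{(i)}(x, u^{(i)}, v^{(i)}) − r₂(x, u^{(i+1)}, v^{(i+1)}) = xᵀ(FᵀP₂^{(i)}F + GᵀP₂^{(i)}G − P₂^{(i)})x). Then the closed-loop second-moment recursion X_{k+1} = FX_kFᵀ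 + GX_kGᵀ converges to the zero matrix for every positive semidefinite initial X₀; that is, the closed-loop stochastic system x_{k+1} = Fx_k + Gx_kω_k is asymptotically stable in the mean square. -/
open Matrix Filter

open scoped MatrixOrder Matrix.Norms.L2Operator in
/-- A positive definite real matrix is of the form `Bᵀ B` with `B` invertible. -/
theorem Matrix.PosDef.exists_isUnit_eq_transpose_mul_self {n : ℕ}
    {M : Matrix (Fin n) (Fin n) ℝ} (hM : M.PosDef) :
    ∃ B : Matrix (Fin n) (Fin n) ℝ, IsUnit B ∧ M = Bᵀ * B := by
  obtain ⟨B, hB, h⟩ := CStarAlgebra.isStrictlyPositive_iff_eq_star_mul_self.mp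
    hM.isStrictlyPositive
  exact ⟨B, hB, by rw [h, star_eq_conjTranspose, conjTranspose_eq_transpose_of_trivial]⟩

/-- The entries of a positive semidefinite real matrix are bounded by its trace. -/
theorem Matrix.PosSemidef.abs_apply_le_trace_s16 {n : ℕ}
    {Z : Matrix (Fin n) (Fin n) ℝ} (hZ : Z.PosSemidef) (i j : Fin n) :
    |Z i j| ≤ Z.trace := by
  have hsymm : Z j i = Z i j := by simpa using hZ.isHermitian.apply i j
  have hdiag (i : Fin n) : Z i i ≤ Z.trace :=
    Finset.single_le_sum (f := fun i => Z i i) (fun _ _ => hZ.diag_nonneg) (Finset.mem_univ i)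
  have hadd := hZ.dotProduct_mulVec_nonneg (Pi.single i 1 + Pi.single j 1)
  have hsub := hZ.dotProduct_mulVec_nonneg (Pi.single i 1 - Pi.single j 1)
  simp [mulVec_add, mulVec_sub, add_dotProduct, sub_dotProduct] at hadd hsub
  rw [abs_le]
  constructor <;> linarith [hdiag i, hdiag j]

/-- The trace of the product of two positive semidefinite real matrices, one of them definite,
is nonnegative. -/
theorem Matrix.PosDef.trace_mul_nonneg {n : ℕ} {M X : Matrix (Fin n) (Fin n) ℝ}
    (hM : M.PosDef) (hX : X.PosSemidef) : 0 ≤ (M * X).trace := by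
  obtain ⟨B, -, rfl⟩ := hM.exists_isUnit_eq_transpose_mul_self
  rw [mul_assoc, trace_mul_comm]
  simpa using (hX.mul_mul_conjTranspose_same B).trace_nonneg

/-- A sequence of positive semidefinite matrices tends to zero as soon as its traces against a
positive definite matrix do. -/
theorem Matrix.PosDef.tendsto_zero_of_trace_mul {n : ℕ} {M : Matrix (Fin n) (Fin n) ℝ}
    (hM : M.PosDef) {X : ℕ → Matrix (Fin n) (Fin n) ℝ} (hX : ∀ k, (X k).PosSemidef)
    (h : Tendsto (fun k => (M * X k).trace) atTop (nhds 0)) : Tendsto X atTop (nhds 0) := by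
  obtain ⟨B, hB, rfl⟩ := hM.exists_isUnit_eq_transpose_mul_self
  have hdet : IsUnit B.det := (isUnit_iff_isUnit_det B).mp hB
  have hdetT : IsUnit Bᵀ.det := by rwa [det_transpose]
  have hpsd (k : ℕ) : (B * X k * Bᵀ).PosSemidef := by
    simpa using (hX k).mul_mul_conjTranspose_same B
  have htrace (k : ℕ) : (Bᵀ * B * X k).trace = (B * X k * Bᵀ).trace := by
    rw [mul_assoc, trace_mul_comm]
  have hconj : Tendsto (fun k => B * X k * Bᵀ) atTop (nhds 0) := by
    refine tendsto_pi_nhds.mpr fun i => tendsto_pi_nhds.mpr fun j => ?_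
    exact squeeze_zero_norm
      (fun k => ((hpsd k).abs_apply_le_trace_s16 i j).trans_eq (htrace k).symm) h
  have hcont : Continuous fun Z : Matrix (Fin n) (Fin n) ℝ => B⁻¹ * Z * Bᵀ⁻¹ := by fun_prop
  have hlim := (hcont.tendsto 0).comp hconj
  simp only [mul_zero, zero_mul] at hlim
  refine hlim.congr fun k => ?_
  simp only [Function.comp_apply, ← mul_assoc]
  rw [nonsing_inv_mul _ hdet, one_mul, mul_nonsing_inv_cancel_right _ _ hdetT]

/-- Stability under the strict stopping condition: if there exists
a symmetric positive definite `P` with `FᵀPF + GᵀPG − P` negative definite, where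
`F = A₁ + B₁K₂ + C₁K₁` and `G = A₂ + C₂K₁` are the closed-loop coefficient
matrices, then the closed-loop second-moment recursion
`X_{k+1} = FX_kFᵀ + GX_kGᵀ` converges to zero for every PSD initial `X₀`; i.e.
the closed-loop stochastic system `x_{k+1} = Fx_k + Gx_kω_k` is asymptotically
stable in the mean square. -/
theorem stability_under_strict_stopping_condition
    (n m₁ m₂ : ℕ) (hn : 0 < n) (hm₁ : 0 < m₁) (hm₂ : 0 < m₂)
    (A₁ A₂ : Matrix (Fin n) (Fin n) ℝ)
    (B₁ : Matrix (Fin n) (Fin m₁) ℝ)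
    (C₁ C₂ : Matrix (Fin n) (Fin m₂) ℝ)
    (Q : Matrix (Fin n) (Fin n) ℝ) (hQ : Qᵀ = Q)
    (γ : ℝ) (hγ : 0 < γ)
    (K₁ : Matrix (Fin m₂) (Fin n) ℝ) (K₂ : Matrix (Fin m₁) (Fin n) ℝ)
    (F G : Matrix (Fin n) (Fin n) ℝ)
    (hF : F = A₁ + B₁ * K₂ + C₁ * K₁) (hG : G = A₂ + C₂ * K₁)
    (P : Matrix (Fin n) (Fin n) ℝ) (hP : P.PosDef)
    (hLyap : (-(Fᵀ * P * F + Gᵀ * P * G - P)).PosDef) :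
    ∀ X₀ : Matrix (Fin n) (Fin n) ℝ, X₀.PosSemidef →
      Tendsto (fun k => (fun X => F * X * Fᵀ + G * X * Gᵀ)^[k] X₀)
        atTop (nhds 0) := by
  intro X₀ hX₀
  set X : ℕ → Matrix (Fin n) (Fin n) ℝ :=
    fun k => (fun X => F * X * Fᵀ + G * X * Gᵀ)^[k] X₀ with hX
  have hstep (k : ℕ) : X (k + 1) = F * X k * Fᵀ + G * X k * Gᵀ := by
    simp only [hX, Function.iterate_succ_apply']
  have hpsd (k : ℕ) : (X k).PosSemidef := by
    induction k with
    | zero => exact hX₀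
    | succ k ih =>
      rw [hstep]
      simpa using (ih.mul_mul_conjTranspose_same F).add (ih.mul_mul_conjTranspose_same G)
  set M := -(Fᵀ * P * F + Gᵀ * P * G - P)
  have hdecr (k : ℕ) : (M * X k).trace = (P * X k).trace - (P * X (k + 1)).trace := by
    have hcycle (H : Matrix (Fin n) (Fin n) ℝ) :
        (P * (H * X k * Hᵀ)).trace = (Hᵀ * P * H * X k).trace := by
      rw [← mul_assoc, trace_mul_comm]
      simp only [mul_assoc]
    rw [hstep, mul_add, trace_add, hcycle F, hcycle G]
    simp only [M, neg_sub, sub_mul, add_mul, trace_sub, trace_add]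
  have hsum : Summable fun k => (M * X k).trace := by
    refine summable_of_sum_range_le (c := (P * X 0).trace)
      (fun k => hLyap.trace_mul_nonneg (hpsd k)) fun N => ?_
    simp only [hdecr]
    rw [Finset.sum_range_sub']
    linarith [hP.trace_mul_nonneg (hpsd N)]
  exact hLyap.tendsto_zero_of_trace_mul hpsd hsum.tendsto_atTop_zero
end
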